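/- Let f be a nonnegative integrable weight and t a nonnegative trigonometric polynomial on [-π,π]. If the sequence σ_n²(f) is weakly varying (i.e., σ_{n+1}²(f)/σ_n²(f) → 1), then liminf_{n→∞} σ_n²(ft)/σ_n²(f) ≥ t(0). -/

import Mathlib

open MeasureTheory Filter

/-- The variance of the BLUE: the infimum of `∫ |q(e^{iλ})|² h(λ) dλ` over
polynomials `q` of degree at most `n` with `q(1) = 1`. -/
noncomputable def sigmaSq (h : ℝ → ℝ) (n : ℕ) : ℝ :=
  sInf {v : ℝ | ∃ q : Polynomial ℂ, q.natDegree ≤ n ∧ q.eval 1 = 1 ∧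
    v = ∫ t in (-Real.pi)..Real.pi, ‖q.eval (Complex.exp (Complex.I * t))‖ ^ 2 * h t}

lemma sig_bdd (h : ℝ → ℝ) (h0 : ∀ x, 0 ≤ h x) (n : ℕ) :
    BddBelow {v : ℝ | ∃ q : Polynomial ℂ, q.natDegree ≤ n ∧ q.eval 1 = 1 ∧
    v = ∫ t in (-Real.pi)..Real.pi, ‖q.eval (Complex.exp (Complex.I * t))‖ ^ 2 * h t} := by
  refine ⟨0, ?_⟩
  rintro v ⟨q, -, -, rfl⟩
  apply intervalIntegral.integral_nonneg (by linarith [Real.pi_pos])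
  intro x _
  exact mul_nonneg (by positivity) (h0 x)

lemma sig_le (h₁ h₂ : ℝ → ℝ) (h0 : ∀ x, 0 ≤ h₁ x) (n m : ℕ) (C : ℝ) (hC : 0 < C)
    (H : ∀ q : Polynomial ℂ, q.natDegree ≤ m → q.eval 1 = 1 →
      ∃ r : Polynomial ℂ, r.natDegree ≤ n ∧ r.eval 1 = 1 ∧
      (∫ t in (-Real.pi)..Real.pi, ‖r.eval (Complex.exp (Complex.I * t))‖ ^ 2 * h₁ t) ≤
      C * ∫ t in (-Real.pi)..Real.pi, ‖q.eval (Complex.exp (Complex.I * t))‖ ^ 2 * h₂ t) :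
    sigmaSq h₁ n ≤ C * sigmaSq h₂ m := by
  rw [← div_le_iff₀' hC]
  unfold sigmaSq
  apply le_csInf
  · exact ⟨_, 1, by simp, by simp, rfl⟩
  · rintro v ⟨q, hq, hq1, rfl⟩
    rw [div_le_iff₀' hC]
    obtain ⟨r, hr, hr1, hle⟩ := H q hq hq1
    exact (csInf_le (sig_bdd h₁ h0 n) ⟨r, hr, hr1, rfl⟩).trans hle

lemma poly_int (h : ℝ → ℝ) (hfi : IntervalIntegrable h volume (-Real.pi) Real.pi)
    (q : Polynomial ℂ) : IntervalIntegrable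
      (fun t : ℝ => ‖q.eval (Complex.exp (Complex.I * t))‖ ^ 2 * h t)
      volume (-Real.pi) Real.pi := by
  apply hfi.continuousOn_mul
  apply Continuous.continuousOn
  fun_prop

lemma fourier_exp (k : ℤ) (x : ℝ) :
    fourier k (x : AddCircle (2 * Real.pi)) = Complex.exp (Complex.I * k * x) := by
  rw [fourier_coe_apply]
  congr 1
  have : (Real.pi : ℂ) ≠ 0 := by exact_mod_cast Real.pi_ne_zero
  push_cast
  field_simp

lemma span_poly (F : C(AddCircle (2 * Real.pi), ℂ))
    (hF : F ∈ Submodule.span ℂ (Set.range (fourier (T := 2 * Real.pi)))) :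
    ∃ (N : ℕ) (P : Polynomial ℂ), ∀ x : ℝ,
      F x * Complex.exp (Complex.I * x) ^ N = P.eval (Complex.exp (Complex.I * x)) := by
  induction hF using Submodule.span_induction with
  | mem F h =>
    obtain ⟨k, rfl⟩ := h
    refine ⟨k.natAbs, Polynomial.X ^ (k + k.natAbs).toNat, fun x => ?_⟩
    rw [fourier_exp, Polynomial.eval_pow, Polynomial.eval_X, ← Complex.exp_nat_mul,
      ← Complex.exp_nat_mul, ← Complex.exp_add]
    congr 1
    obtain ⟨a, ha⟩ : ∃ a : ℕ, a = k.natAbs := ⟨_, rfl⟩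
    rw [← ha]
    obtain ⟨b, hb⟩ : ∃ b : ℕ, b = (k + a).toNat := ⟨_, rfl⟩
    rw [← hb]
    have h : (b : ℤ) = k + a := by omega
    have h' : (b : ℂ) = k + a := by exact_mod_cast h
    rw [h']; ring
  | zero => exact ⟨0, 0, by simp⟩
  | add F G _ _ hF hG =>
    obtain ⟨N, P, hP⟩ := hF
    obtain ⟨M, Q, hQ⟩ := hG
    refine ⟨N + M, P * Polynomial.X ^ M + Q * Polynomial.X ^ N, fun x => ?_⟩
    simp only [Polynomial.eval_add, Polynomial.eval_mul, Polynomial.eval_pow, Polynomial.eval_X,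
      ← hP, ← hQ, ContinuousMap.add_apply]
    ring
  | smul a F _ hF =>
    obtain ⟨N, P, hP⟩ := hF
    refine ⟨N, Polynomial.C a * P, fun x => ?_⟩
    simp only [Polynomial.eval_mul, Polynomial.eval_C, ← hP, ContinuousMap.smul_apply, smul_eq_mul]
    ring

lemma exp_norm (x : ℝ) (N : ℕ) : ‖Complex.exp (Complex.I * x) ^ N‖ = 1 := by
  rw [norm_pow, mul_comm, Complex.norm_exp_ofReal_mul_I, one_pow]

lemma exists_p (t : ℝ → ℝ) (ht0 : ∀ x, 0 ≤ t x) (ν : ℕ) (c : ℤ → ℂ)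
    (ht : ∀ x : ℝ, (t x : ℂ) = ∑ k ∈ Finset.Icc (-(ν : ℤ)) (ν : ℤ),
        c k * Complex.exp (Complex.I * (k : ℂ) * (x : ℂ)))
    (M : ℝ) (hM : 0 < M) (htM : ∀ x, t x ≤ M ^ 2)
    (hp : 0 < t 0) (ε : ℝ) (hε : 0 < ε) (hε1 : ε < 1) :
    ∃ p : Polynomial ℂ, (∀ x : ℝ, ‖p.eval (Complex.exp (Complex.I * x))‖ ^ 2 ≤ (1 + ε) ^ 2 * t x) ∧
      (1 - ε) ^ 2 * t 0 ≤ ‖p.eval 1‖ ^ 2 := by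
  let T : C(AddCircle (2 * Real.pi), ℂ) :=
    ∑ k ∈ Finset.Icc (-(ν : ℤ)) (ν : ℤ), c k • fourier k
  have hTspan : T ∈ Submodule.span ℂ (Set.range (fourier (T := 2 * Real.pi))) :=
    Submodule.sum_mem _ fun k _ => Submodule.smul_mem _ _ (Submodule.subset_span ⟨k, rfl⟩)
  have hT : ∀ x : ℝ, T x = t x := by
    intro x
    rw [ht x]
    simp only [T, ContinuousMap.coe_sum, Finset.sum_apply, ContinuousMap.smul_apply, fourier_exp,
      smul_eq_mul]
  let g : C(AddCircle (2 * Real.pi), ℂ) :=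
    ⟨fun y => (((Real.sqrt (max (T y).re (t 0)))⁻¹ : ℝ) : ℂ), by
      refine Complex.continuous_ofReal.comp (Continuous.inv₀ (by fun_prop) fun y => ?_)
      exact (Real.sqrt_pos.2 (lt_max_of_lt_right hp)).ne'⟩
  have : Fact (0 < 2 * Real.pi) := ⟨by positivity⟩
  have hg : g ∈ (Submodule.span ℂ (Set.range (fourier (T := 2 * Real.pi)))).topologicalClosure := by
    rw [span_fourier_closure_eq_top]; trivial
  obtain ⟨S, hS, hd⟩ := Metric.mem_closure_iff.1 hg (ε / M) (by positivity)
  obtain ⟨N₁, P, hP⟩ := span_poly T hTspan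
  obtain ⟨N₂, Q, hQ⟩ := span_poly S hS
  have hval : ∀ x : ℝ, ‖(P * Q).eval (Complex.exp (Complex.I * x))‖ ^ 2
      = (Real.sqrt (t x) * ‖S x‖) ^ 2 * t x := by
    intro x
    rw [Polynomial.eval_mul, ← hP, ← hQ, norm_mul, norm_mul, norm_mul, exp_norm, exp_norm, hT,
      Complex.norm_real, Real.norm_of_nonneg (ht0 x), mul_pow _ (‖S x‖), Real.sq_sqrt (ht0 x)]
    ring
  have hsM : ∀ x, Real.sqrt (t x) ≤ M := fun x => by
    rw [Real.sqrt_le_left hM.le]; exact htM x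
  have hdx : ∀ x : ℝ, Real.sqrt (t x) * ‖g x - S x‖ ≤ ε := by
    intro x
    have h1 : ‖g x - S x‖ ≤ ε / M := by
      rw [← dist_eq_norm]; exact (ContinuousMap.dist_apply_le_dist _).trans hd.le
    calc _ ≤ M * (ε / M) := mul_le_mul (hsM x) h1 (norm_nonneg _) hM.le
      _ = ε := by field_simp
  have hgn : ∀ x : ℝ, ‖g x‖ = (Real.sqrt (max (t x) (t 0)))⁻¹ := by
    intro x
    simp only [g, ContinuousMap.coe_mk, hT, Complex.ofReal_re]
    rw [Complex.norm_real, Real.norm_of_nonneg (by positivity)]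
  refine ⟨P * Q, fun x => ?_, ?_⟩
  · rw [hval]
    apply mul_le_mul_of_nonneg_right _ (ht0 x)
    apply pow_le_pow_left₀ (by positivity)
    have h2 : ‖S x‖ ≤ ‖g x‖ + ‖g x - S x‖ := norm_le_insert _ _
    have h3 : Real.sqrt (t x) * ‖g x‖ ≤ 1 := by
      rw [hgn, ← div_eq_mul_inv, div_le_one (Real.sqrt_pos.2 (lt_max_of_lt_right hp))]
      exact Real.sqrt_le_sqrt (le_max_left _ _)
    have := mul_le_mul_of_nonneg_left h2 (Real.sqrt_nonneg (t x))
    linarith [hdx x]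
  · have h1 := hval 0
    rw [Complex.ofReal_zero, mul_zero, Complex.exp_zero] at h1
    rw [h1]
    apply mul_le_mul_of_nonneg_right _ (ht0 0)
    apply pow_le_pow_left₀ (by linarith)
    have h2 : ‖g ((0:ℝ) : AddCircle (2 * Real.pi))‖ ≤ ‖S ((0:ℝ) : AddCircle (2 * Real.pi))‖ +
       ‖g ((0:ℝ) : AddCircle (2 * Real.pi)) - S ((0:ℝ) : AddCircle (2 * Real.pi))‖ :=
       norm_le_norm_add_norm_sub' _ _
    have h3 : Real.sqrt (t 0) * ‖g ((0:ℝ) : AddCircle (2 * Real.pi))‖ = 1 := by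
      rw [hgn, max_self, mul_inv_cancel₀ (Real.sqrt_pos.2 hp).ne']
    have := mul_le_mul_of_nonneg_left h2 (Real.sqrt_nonneg (t 0))
    linarith [hdx 0]

lemma ratio_shift (s : ℕ → ℝ) (hpos : ∀ n, 0 < s n)
    (h : Tendsto (fun n => s (n + 1) / s n) atTop (nhds 1)) (m : ℕ) :
    Tendsto (fun n => s (n + m) / s n) atTop (nhds 1) := by
  induction m with
  | zero => simp [div_self (hpos _).ne']
  | succ m ih =>
    have h2 := (h.comp (tendsto_add_atTop_nat m)).mul ih
    rw [one_mul] at h2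
    refine h2.congr fun n => ?_
    have := (hpos n).ne'
    have := (hpos (n + m)).ne'
    simp only [Function.comp, ← add_assoc]
    field_simp

theorem stmt16 (f t : ℝ → ℝ)
    (hf0 : ∀ x, 0 ≤ f x)
    (hfi : IntervalIntegrable f volume (-Real.pi) Real.pi)
    (ht0 : ∀ x, 0 ≤ t x)
    (htrig : ∃ (ν : ℕ) (c : ℤ → ℂ), ∀ x : ℝ,
      (t x : ℂ) = ∑ k ∈ Finset.Icc (-(ν : ℤ)) (ν : ℤ),
        c k * Complex.exp (Complex.I * (k : ℂ) * (x : ℂ)))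
    (hpos : ∀ n, 0 < sigmaSq f n)
    (hwv : Tendsto (fun n => sigmaSq f (n + 1) / sigmaSq f n) atTop (nhds 1)) :
    t 0 ≤ liminf (fun n => sigmaSq (fun x => f x * t x) n / sigmaSq f n) atTop := by
  obtain ⟨ν, c, ht⟩ := htrig
  have hpi : -Real.pi ≤ Real.pi := by linarith [Real.pi_pos]
  have htc : Continuous t := by
    have h1 : t = fun x : ℝ => (∑ k ∈ Finset.Icc (-(ν : ℤ)) (ν : ℤ),
        c k * Complex.exp (Complex.I * (k : ℂ) * (x : ℂ))).re := by
      funext x; rw [← ht, Complex.ofReal_re]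
    rw [h1]; fun_prop
  obtain ⟨M, hM, htM⟩ : ∃ M : ℝ, 0 < M ∧ ∀ x, t x ≤ M ^ 2 := by
    set B := ∑ k ∈ Finset.Icc (-(ν : ℤ)) (ν : ℤ), ‖c k‖
    have hB0 : 0 ≤ B := Finset.sum_nonneg fun _ _ => norm_nonneg _
    have hB : ∀ x, t x ≤ B := by
      intro x
      have h1 : t x = ‖(t x : ℂ)‖ := by rw [Complex.norm_real, Real.norm_of_nonneg (ht0 x)]
      rw [h1, ht]
      refine norm_sum_le_of_le _ fun k _ => ?_
      rw [norm_mul]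
      have : Complex.I * (k : ℂ) * (x : ℂ) = ((k * x : ℝ) : ℂ) * Complex.I := by push_cast; ring
      rw [this, Complex.norm_exp_ofReal_mul_I, mul_one]
    exact ⟨B + 1, by linarith, fun x => by nlinarith [hB x]⟩
  have hfti : IntervalIntegrable (fun x => f x * t x) volume (-Real.pi) Real.pi :=
    hfi.mul_continuousOn htc.continuousOn
  have hft0 : ∀ x, 0 ≤ f x * t x := fun x => mul_nonneg (hf0 x) (ht0 x)
  have hup : ∀ n, sigmaSq (fun x => f x * t x) n / sigmaSq f n ≤ M ^ 2 := by
    intro n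
    rw [div_le_iff₀ (hpos n)]
    refine sig_le _ _ hft0 n n _ (by positivity) fun q hq hq1 => ⟨q, hq, hq1, ?_⟩
    rw [← intervalIntegral.integral_const_mul]
    refine intervalIntegral.integral_mono_on hpi (poly_int _ hfti q)
      ((poly_int _ hfi q).const_mul _) fun x _ => ?_
    have := mul_le_mul_of_nonneg_left (htM x)
      (mul_nonneg (sq_nonneg ‖q.eval (Complex.exp (Complex.I * x))‖) (hf0 x))
    linarith
  have hcob : IsCoboundedUnder (· ≥ ·) atTop
      (fun n => sigmaSq (fun x => f x * t x) n / sigmaSq f n) :=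
    IsBoundedUnder.isCoboundedUnder_ge ⟨M ^ 2, by simpa using ⟨0, fun n _ => hup n⟩⟩
  have hlow0 : ∀ n, 0 ≤ sigmaSq (fun x => f x * t x) n / sigmaSq f n := by
    intro n
    refine div_nonneg (Real.sInf_nonneg ?_) (hpos n).le
    rintro v ⟨q, -, -, rfl⟩
    apply intervalIntegral.integral_nonneg hpi
    intro x _
    exact mul_nonneg (by positivity) (hft0 x)
  rcases (ht0 0).eq_or_lt with h00 | hp
  · rw [← h00]
    exact le_liminf_of_le hcob (Eventually.of_forall hlow0)
  refine le_of_forall_lt_imp_le_of_dense fun b hb => ?_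
  refine le_liminf_of_le hcob ?_
  -- choose the approximation level
  obtain ⟨ε, hε, hε1, hbε⟩ : ∃ ε : ℝ, 0 < ε ∧ ε < 1 ∧
      b < (1 - ε) ^ 2 * t 0 / (1 + ε) ^ 2 := by
    have hc : Tendsto (fun ε : ℝ => (1 - ε) ^ 2 * t 0 / (1 + ε) ^ 2) (nhdsWithin 0 (Set.Ioi 0))
        (nhds (t 0)) := by
      have : ContinuousAt (fun ε : ℝ => (1 - ε) ^ 2 * t 0 / (1 + ε) ^ 2) 0 := by
        apply ContinuousAt.div <;> first | fun_prop | norm_num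
      have h2 := this.tendsto
      simp only [sub_zero, add_zero, one_pow, one_mul, div_one] at h2
      exact h2.mono_left nhdsWithin_le_nhds
    have h1 : ∀ᶠ ε : ℝ in nhdsWithin 0 (Set.Ioi 0), ε < 1 :=
      nhdsWithin_le_nhds (eventually_lt_nhds one_pos)
    obtain ⟨ε, h⟩ := ((hc.eventually (eventually_gt_nhds hb)).and
      (h1.and self_mem_nhdsWithin)).exists
    exact ⟨ε, h.2.2, h.2.1, h.1⟩
  obtain ⟨p, hpx, hp1⟩ := exists_p t ht0 ν c ht M hM htM hp ε hε hε1
  set K := (1 - ε) ^ 2 * t 0 / (1 + ε) ^ 2 with hK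
  have h1ε : 0 < 1 - ε := by linarith
  have hKpos : 0 < K := by positivity
  have hp1pos : 0 < ‖p.eval 1‖ ^ 2 := lt_of_lt_of_le (by positivity) hp1
  have hpne : p.eval 1 ≠ 0 := by
    intro h; simp [h] at hp1pos
  have key : ∀ n, sigmaSq f (n + p.natDegree) ≤ K⁻¹ * sigmaSq (fun x => f x * t x) n := by
    intro n
    refine sig_le _ _ hf0 _ _ _ (by positivity) fun q hq hq1 => ?_
    refine ⟨Polynomial.C (p.eval 1)⁻¹ * (p * q), ?_, ?_, ?_⟩
    · refine (Polynomial.natDegree_C_mul_le _ _).trans (Polynomial.natDegree_mul_le.trans ?_)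
      omega
    · simp [hq1, hpne]
    · rw [← intervalIntegral.integral_const_mul]
      refine intervalIntegral.integral_mono_on hpi (poly_int _ hfi _)
        ((poly_int _ hfti q).const_mul _) fun x _ => ?_
      rw [Polynomial.eval_mul, Polynomial.eval_mul, Polynomial.eval_C, norm_mul, norm_mul,
        norm_inv, mul_pow, mul_pow, inv_pow]
      have hA : (‖p.eval 1‖ ^ 2)⁻¹ * ‖p.eval (Complex.exp (Complex.I * x))‖ ^ 2 ≤ K⁻¹ * t x := by
        calc _ ≤ ((1 - ε) ^ 2 * t 0)⁻¹ * ((1 + ε) ^ 2 * t x) := by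
              apply mul_le_mul _ (hpx x) (by positivity) (by positivity)
              exact inv_anti₀ (by positivity) hp1
          _ = K⁻¹ * t x := by rw [hK, inv_div]; ring
      have := mul_le_mul_of_nonneg_right hA
        (mul_nonneg (sq_nonneg ‖q.eval (Complex.exp (Complex.I * x))‖) (hf0 x))
      linarith
  have hlim := (ratio_shift _ hpos hwv p.natDegree).const_mul K
  rw [mul_one] at hlim
  filter_upwards [hlim.eventually (eventually_gt_nhds hbε)] with n hn
  refine hn.le.trans ?_
  rw [← mul_div_assoc]
  apply div_le_div_of_nonneg_right _ (hpos n).le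
  have := mul_le_mul_of_nonneg_left (key n) hKpos.le
  rwa [← mul_assoc, mul_inv_cancel₀ hKpos.ne', one_mul] at this
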